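/- Let μ be a nonnegative integer and z ∈ ℂ be such that q^{s−z+j} ≠ 1 for all integers a ≤ s ≤ b−1 and all integers −1 ≤ j ≤ μ+1. Then the forward difference in z of Φ_{ν,μ} satisfies Φ_{ν,μ}(z+1) − Φ_{ν,μ}(z) = [μ+1]_q · ( x_{ν−μ}(z+1) − x_{ν−μ}(z) ) · Φ_{ν,μ+1}(z+1). -/

import Mathlib

noncomputable section

/-- `q^w := exp(w · log q)` for a complex exponent `w`. -/
def qp (q : ℝ) (w : ℂ) : ℂ := Complex.exp (w * (Real.log q : ℂ))

/-- The symmetric q-number `[t]_q = (q^{t/2} − q^{−t/2})/(q^{1/2} − q^{−1/2})`. -/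
def qnum (q : ℝ) (t : ℂ) : ℂ :=
  (qp q (t/2) - qp q (-(t/2))) / (qp q (1/2) - qp q (-(1/2)))

/-- Generalized power `[x_k(s) − x_k(z)]^{(n)}` on the q-linear lattice
`x(s) = c₁·q^s + c₂`. -/
def gp (q : ℝ) (c₁ : ℂ) (n : ℕ) (k s z : ℂ) : ℂ :=
  (-1 : ℂ)^n * c₁^n * qp q (-((n*(n-1) : ℕ) : ℂ)/2) * qp q ((n : ℂ) * (z + k/2)) *
    ∏ j ∈ Finset.range n, (1 - qp q (s - z + (j : ℂ)))

/-- The shifted q-linear lattice `x_k(s) = c₁·q^{s+k/2} + c₂`. -/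
def latt (q : ℝ) (c₁ c₂ : ℂ) (k s : ℂ) : ℂ := c₁ * qp q (s + k/2) + c₂

/-- The function `Φ_{ν,μ}(z) = ∑_{s=a}^{b−1} ρ(s)·∇x_{ν+1}(s)/[x_ν(s) − x_ν(z)]^{(μ+1)}`. -/
def Phi (q : ℝ) (c₁ c₂ : ℂ) (ρ : ℤ → ℂ) (a b : ℤ) (ν : ℂ) (μ : ℕ) (z : ℂ) : ℂ :=
  ∑ s ∈ Finset.Icc a (b - 1),
    ρ s * (latt q c₁ c₂ (ν + 1) (s : ℂ) - latt q c₁ c₂ (ν + 1) ((s : ℂ) - 1)) /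
      gp q c₁ (μ + 1) ν (s : ℂ) z

theorem qp_add (q : ℝ) (v w : ℂ) : qp q (v + w) = qp q v * qp q w := by
  simp only [qp, add_mul, Complex.exp_add]

theorem qp_ne_zero (q : ℝ) (w : ℂ) : qp q w ≠ 0 := Complex.exp_ne_zero _

theorem qp_neg (q : ℝ) (w : ℂ) : qp q (-w) = (qp q w)⁻¹ := by
  simp only [qp, neg_mul, Complex.exp_neg]

theorem qp_one {q : ℝ} (hq : 0 < q) : qp q 1 = q := by
  rw [qp, one_mul, ← Complex.ofReal_exp, Real.exp_log hq]

theorem cast_mul_pred (n : ℕ) : ((n * (n - 1) : ℕ) : ℂ) = n * (n - 1) := by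
  cases n <;> simp

theorem gp_succ (q : ℝ) (c₁ : ℂ) (n : ℕ) (k s z : ℂ) :
    gp q c₁ (n + 1) k s z =
      gp q c₁ n k s z * (-c₁ * qp q (-n) * qp q (z + k / 2) * (1 - qp q (s - z + n))) := by
  have h₁ : qp q (-(((n + 1) * (n + 1 - 1) : ℕ) : ℂ) / 2) =
      qp q (-((n * (n - 1) : ℕ) : ℂ) / 2) * qp q (-n) := by
    rw [← qp_add, cast_mul_pred, cast_mul_pred]
    push_cast
    ring_nf
  have h₂ : qp q (((n + 1 : ℕ) : ℂ) * (z + k / 2)) =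
      qp q (n * (z + k / 2)) * qp q (z + k / 2) := by
    rw [← qp_add]
    push_cast
    ring_nf
  simp only [gp, Finset.prod_range_succ, h₁, h₂]
  ring

theorem gp_succ_add_one (q : ℝ) (c₁ : ℂ) (n : ℕ) (k s z : ℂ) :
    gp q c₁ (n + 1) k s (z + 1) =
      gp q c₁ n k s z * (-c₁ * qp q 1 * qp q (z + k / 2) * (1 - qp q (s - z - 1))) := by
  have h₁ : qp q (-(((n + 1) * (n + 1 - 1) : ℕ) : ℂ) / 2) *
      qp q (((n + 1 : ℕ) : ℂ) * (z + 1 + k / 2)) =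
      qp q (-((n * (n - 1) : ℕ) : ℂ) / 2) * qp q (n * (z + k / 2)) *
        (qp q 1 * qp q (z + k / 2)) := by
    simp only [← qp_add, cast_mul_pred]
    push_cast
    ring_nf
  have h₂ : ∏ j ∈ Finset.range (n + 1), (1 - qp q (s - (z + 1) + (j : ℂ))) =
      (∏ j ∈ Finset.range n, (1 - qp q (s - z + (j : ℂ)))) * (1 - qp q (s - z - 1)) := by
    rw [Finset.prod_range_succ']
    congr 1
    · refine Finset.prod_congr rfl fun j _ => ?_
      push_cast
      ring_nf
    · push_cast
      ring_nf
  simp only [gp, h₂]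
  linear_combination (-1 : ℂ) ^ (n + 1) * c₁ ^ (n + 1) *
    ((∏ j ∈ Finset.range n, (1 - qp q (s - z + (j : ℂ)))) * (1 - qp q (s - z - 1))) * h₁

theorem gp_ne_zero (q : ℝ) {c₁ : ℂ} (hc₁ : c₁ ≠ 0) (n : ℕ) (k s z : ℂ)
    (h : ∀ j < n, qp q (s - z + (j : ℂ)) ≠ 1) : gp q c₁ n k s z ≠ 0 := by
  have hp : ∏ j ∈ Finset.range n, (1 - qp q (s - z + (j : ℂ))) ≠ 0 :=
    Finset.prod_ne_zero_iff.2 fun j hj => sub_ne_zero.2 (h j (Finset.mem_range.1 hj)).symm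
  simp [gp, hc₁, qp_ne_zero, hp]

theorem inv_gp_add_one_sub_inv_gp (q : ℝ) {c₁ : ℂ} (n : ℕ) (k s z : ℂ)
    (h : gp q c₁ (n + 1) k s (z + 1) ≠ 0) :
    (gp q c₁ n k s (z + 1))⁻¹ - (gp q c₁ n k s z)⁻¹ =
      c₁ * qp q 1 * qp q (z + k / 2) * (1 - qp q (-n)) * (gp q c₁ (n + 1) k s (z + 1))⁻¹ := by
  have h₁ := gp_succ q c₁ n k s (z + 1)
  have h₂ := gp_succ_add_one q c₁ n k s z
  have hB : gp q c₁ n k s (z + 1) ≠ 0 := left_ne_zero_of_mul (h₁ ▸ h)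
  have hA : gp q c₁ n k s z ≠ 0 := left_ne_zero_of_mul (h₂ ▸ h)
  have hz : qp q (z + 1 + k / 2) = qp q 1 * qp q (z + k / 2) := by
    rw [← qp_add]
    ring_nf
  have hu : qp q (-n) * qp q (s - (z + 1) + n) = qp q (s - z - 1) := by
    rw [← qp_add]
    ring_nf
  have e₁ : (gp q c₁ n k s (z + 1))⁻¹ = (-c₁ * qp q (-n) * qp q (z + 1 + k / 2) *
      (1 - qp q (s - (z + 1) + n))) * (gp q c₁ (n + 1) k s (z + 1))⁻¹ := by
    rw [eq_mul_inv_iff_mul_eq₀ h, h₁, inv_mul_cancel_left₀ hB]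
  have e₂ : (gp q c₁ n k s z)⁻¹ = (-c₁ * qp q 1 * qp q (z + k / 2) *
      (1 - qp q (s - z - 1))) * (gp q c₁ (n + 1) k s (z + 1))⁻¹ := by
    rw [eq_mul_inv_iff_mul_eq₀ h, h₂, inv_mul_cancel_left₀ hA]
  rw [e₁, e₂, hz, ← hu]
  ring

theorem qnum_mul_latt_sub {q : ℝ} (hq : 0 < q) (hq1 : q ≠ 1) (c₁ c₂ k m z : ℂ) :
    qnum q (m + 1) * (latt q c₁ c₂ (k - m) (z + 1) - latt q c₁ c₂ (k - m) z) =
      c₁ * qp q 1 * qp q (z + k / 2) * (1 - qp q (-(m + 1))) := by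
  have hh : qp q 1 = qp q (1 / 2) * qp q (1 / 2) := by
    rw [← qp_add]
    norm_num
  have hne : qp q (1 / 2) * qp q (1 / 2) - 1 ≠ 0 := by
    rw [← hh, qp_one hq, sub_ne_zero]
    exact_mod_cast hq1
  have hm : qp q (m + 1) =
      qp q (m / 2) * qp q (m / 2) * (qp q (1 / 2) * qp q (1 / 2)) := by
    simp only [← qp_add]
    ring_nf
  have hm2 : qp q ((m + 1) / 2) = qp q (m / 2) * qp q (1 / 2) := by
    rw [← qp_add]
    ring_nf
  have hz : qp q (z + (k - m) / 2) = qp q (z + k / 2) * (qp q (m / 2))⁻¹ := by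
    rw [← qp_neg, ← qp_add]
    ring_nf
  have hz1 : qp q (z + 1 + (k - m) / 2) =
      qp q (1 / 2) * qp q (1 / 2) * (qp q (z + k / 2) * (qp q (m / 2))⁻¹) := by
    rw [← hz, ← hh, ← qp_add]
    ring_nf
  have ht := qp_ne_zero q (m / 2)
  have hr := qp_ne_zero q (1 / 2)
  have hd : qp q (1 / 2) - (qp q (1 / 2))⁻¹ ≠ 0 := fun h => hne <| by
    linear_combination qp q (1 / 2) * h + mul_inv_cancel₀ hr
  rw [qnum, latt, latt, qp_neg, qp_neg, qp_neg, hm, hm2, hz1, hz, hh, div_mul_eq_mul_div,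
    div_eq_iff hd]
  field_simp
  ring

theorem stmt7 (q : ℝ) (hq : 0 < q) (hq1 : q ≠ 1) (c₁ c₂ : ℂ) (hc₁ : c₁ ≠ 0)
    (a b : ℤ) (hab : a < b) (ρ : ℤ → ℂ) (ν : ℂ) (μ : ℕ) (z : ℂ)
    (hadm : ∀ s : ℤ, a ≤ s → s ≤ b - 1 → ∀ j : ℤ, -1 ≤ j → j ≤ (μ : ℤ) + 1 →
      qp q ((s : ℂ) - z + (j : ℂ)) ≠ 1) :
    Phi q c₁ c₂ ρ a b ν μ (z + 1) - Phi q c₁ c₂ ρ a b ν μ z =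
      qnum q ((μ : ℂ) + 1) *
        (latt q c₁ c₂ (ν - (μ : ℂ)) (z + 1) - latt q c₁ c₂ (ν - (μ : ℂ)) z) *
        Phi q c₁ c₂ ρ a b ν (μ + 1) (z + 1) := by
  rw [qnum_mul_latt_sub hq hq1, Phi, Phi, Phi, ← Finset.sum_sub_distrib, Finset.mul_sum]
  refine Finset.sum_congr rfl fun s hs => ?_
  obtain ⟨has, hsb⟩ := Finset.mem_Icc.1 hs
  have hG : gp q c₁ (μ + 1 + 1) ν (s : ℂ) (z + 1) ≠ 0 := by
    refine gp_ne_zero q hc₁ _ _ _ _ fun j hj => ?_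
    convert hadm s has hsb ((j : ℤ) - 1) (by omega) (by omega) using 2
    push_cast
    ring
  have key := inv_gp_add_one_sub_inv_gp q (μ + 1) ν (s : ℂ) z hG
  push_cast at key
  simp only [div_eq_mul_inv] at key ⊢
  linear_combination
    ρ s * (latt q c₁ c₂ (ν + 1) (s : ℂ) - latt q c₁ c₂ (ν + 1) ((s : ℂ) - 1)) * key
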